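/- Let S ⊆ G_d be such that p(S) is a vertex of the White Whale H_∞^+(d,1), and let g ∈ S. If |S| < 2^{d−1}, then the vector 𝟏 − g does not belong to S. -/

import Mathlib

/-- The set `G_d` of generators of the White Whale:
all nonzero 0/1-valued vectors of `ℝ^d`. -/
def whaleGens (d : ℕ) : Set (Fin d → ℝ) :=
  {g | g ≠ 0 ∧ ∀ i, g i = 0 ∨ g i = 1}

/-- The point `p(S)`: the sum of the vectors in `S` (with `p(∅) = 0`). -/
noncomputable def whaleSum {d : ℕ} (S : Set (Fin d → ℝ)) : Fin d → ℝ :=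
  ∑ᶠ g ∈ S, g

/-- The White Whale `H_∞^+(d,1)`: the convex hull of the points `p(S)`
over all subsets `S ⊆ G_d`. -/
noncomputable def whiteWhale (d : ℕ) : Set (Fin d → ℝ) :=
  convexHull ℝ {x | ∃ S : Set (Fin d → ℝ), S ⊆ whaleGens d ∧ x = whaleSum S}

/-- A vertex of the White Whale is an extreme point of it. -/
def IsWhaleVertex (d : ℕ) (x : Fin d → ℝ) : Prop :=
  x ∈ Set.extremePoints ℝ (whiteWhale d)

theorem zero_one_vector_ncard (d : ℕ) :
    {h : Fin d → ℝ | ∀ i, h i = 0 ∨ h i = 1}.ncard = 2 ^ d := by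
  have h_eq : {h : Fin d → ℝ | ∀ i, h i = 0 ∨ h i = 1} =
      ((Fintype.piFinset fun _ : Fin d => ({0, 1} : Finset ℝ)) : Set (Fin d → ℝ)) := by
    ext h
    simp
  rw [h_eq, Set.ncard_coe_finset, Fintype.card_piFinset]
  simp

theorem whaleGens_finite (d : ℕ) : (whaleGens d).Finite := by
  refine (Set.finite_of_ncard_pos (s := {h : Fin d → ℝ | ∀ i, h i = 0 ∨ h i = 1}) ?_).subset
    fun g hg => hg.2
  rw [zero_one_vector_ncard]
  positivity

theorem whaleSum_mem_whiteWhale {d : ℕ} {S : Set (Fin d → ℝ)} (hS : S ⊆ whaleGens d) :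
    whaleSum S ∈ whiteWhale d :=
  subset_convexHull ℝ _ ⟨S, hS, rfl⟩

/-- Exchanging a generator of `S` for a 0/1-valued vector outside `S` stays in the White Whale. -/
theorem whaleSum_sub_add_mem_whiteWhale {d : ℕ} {S : Set (Fin d → ℝ)} (hS : S ⊆ whaleGens d)
    {g h : Fin d → ℝ} (hg : g ∈ S) (hh : ∀ i, h i = 0 ∨ h i = 1) (hhS : h ∉ S) :
    whaleSum S - g + h ∈ whiteWhale d := by
  have hfin : (S \ {g}).Finite := ((whaleGens_finite d).subset hS).subset Set.sdiff_subset
  have hsub : S \ {g} ⊆ whaleGens d := Set.sdiff_subset.trans hS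
  have hsum : whaleSum S = g + whaleSum (S \ {g}) := by
    have := finsum_mem_insert (fun x : Fin d → ℝ => x) (a := g) (s := S \ {g}) (by simp) hfin
    rwa [Set.insert_sdiff_singleton, Set.insert_eq_of_mem hg] at this
  rw [hsum, add_sub_cancel_left]
  by_cases h_zero : h = 0
  · rw [h_zero, add_zero]
    exact whaleSum_mem_whiteWhale hsub
  · have hins : whaleSum (insert h (S \ {g})) = h + whaleSum (S \ {g}) :=
      finsum_mem_insert (fun x : Fin d → ℝ => x) (fun hm => hhS hm.1) hfin
    rw [add_comm, ← hins]
    exact whaleSum_mem_whiteWhale (Set.insert_subset ⟨h_zero, hh⟩ hsub)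

/-- If `p(S)` is a vertex and `S` contains a complementary pair, then `S` meets every
complementary pair of 0/1-valued vectors. -/
theorem IsWhaleVertex.mem_or_compl_mem {d : ℕ} {S : Set (Fin d → ℝ)} (hS : S ⊆ whaleGens d)
    (hv : IsWhaleVertex d (whaleSum S)) {g : Fin d → ℝ} (hg : g ∈ S) (hg' : 1 - g ∈ S)
    {h : Fin d → ℝ} (hh : ∀ i, h i = 0 ∨ h i = 1) : h ∈ S ∨ 1 - h ∈ S := by
  by_contra! hc
  have hh' : ∀ i, (1 - h) i = 0 ∨ (1 - h) i = 1 := fun i => by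
    rcases hh i with hi | hi <;> simp [hi]
  have hseg : whaleSum S ∈
      openSegment ℝ (whaleSum S - g + h) (whaleSum S - (1 - g) + (1 - h)) := by
    refine ⟨1 / 2, 1 / 2, by norm_num, by norm_num, by norm_num, ?_⟩
    module
  have heq := hv.2 (whaleSum_sub_add_mem_whiteWhale hS hg hh hc.1)
    (whaleSum_sub_add_mem_whiteWhale hS hg' hh' hc.2) hseg
  have hgh : h = g := by
    rw [sub_add_eq_add_sub, sub_eq_iff_eq_add] at heq
    exact add_left_cancel heq
  exact hc.1 (hgh ▸ hg)

/-- If p(S) is a vertex of the White Whale, g ∈ S and |S| < 2^(d−1), then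
𝟏 − g does not belong to S. -/
theorem whale_not_mem_compl (d : ℕ) (hd : 1 ≤ d)
    (S : Set (Fin d → ℝ)) (hS : S ⊆ whaleGens d)
    (hv : IsWhaleVertex d (whaleSum S))
    (g : Fin d → ℝ) (hg : g ∈ S) (hcard : S.ncard < 2 ^ (d - 1)) :
    ((fun _ : Fin d => (1 : ℝ)) - g) ∉ S := by
  change (1 - g) ∉ S
  intro hg'
  have hfin : S.Finite := (whaleGens_finite d).subset hS
  have hcover : {h : Fin d → ℝ | ∀ i, h i = 0 ∨ h i = 1} ⊆ S ∪ (fun x => 1 - x) '' S := by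
    intro h hh
    rcases hv.mem_or_compl_mem hS hg hg' hh with hm | hm
    · exact Or.inl hm
    · exact Or.inr ⟨1 - h, hm, sub_sub_cancel 1 h⟩
  have hle := (Set.ncard_le_ncard hcover (hfin.union (hfin.image _))).trans
    (Set.ncard_union_le _ _)
  rw [zero_one_vector_ncard] at hle
  have himage := Set.ncard_image_le (f := fun x : Fin d → ℝ => 1 - x) hfin
  have hpow : 2 ^ d = 2 ^ (d - 1) * 2 := by rw [← pow_succ, Nat.sub_add_cancel hd]
  omega
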